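/- For every ε ∈ (0, 1/2] and every deterministic online algorithm for goods, there exists a goods instance with two agents having additive bi-valued valuation functions such that the final allocation A^t produced by the algorithm is not non-wasteful, or is neither (1/2+ε)-EF1 nor (1/3+ε)-MMS. In particular, for two agents with additive bi-valued valuations no deterministic online algorithm can compute a non-wasteful allocation that is (1/2+ε)-EF1 or (1/3+ε)-MMS for any ε > 0. -/

import Mathlib

open Finset

namespace OnlineFair

/-- The valuation/cost profile restricted to the items `0, …, k` that have arrived
by the end of (0-indexed) round `k`: an online algorithm's decision at round `k`
may depend only on this restriction. -/
def restrictVal {n : ℕ} (v : Fin n → Finset ℕ → ℝ) (k : ℕ) : Fin n → Finset ℕ → ℝ :=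
  fun i S => v i (S ∩ Finset.range (k + 1))

/-- A deterministic online algorithm for goods with `n` agents: at each round it sees
only the valuations restricted to the arrived items, and either assigns the newly
arrived item to an agent or discards it (`none`). -/
abbrev GoodsAlg (n : ℕ) : Type := ℕ → (Fin n → Finset ℕ → ℝ) → Option (Fin n)

/-- The allocation produced by a goods algorithm after `k` rounds
(the arrived items are `0, …, k-1`; item `k-1` arrived in the last round). -/
def runGoods {n : ℕ} (alg : GoodsAlg n) (v : Fin n → Finset ℕ → ℝ) : ℕ → Fin n → Finset ℕ
  | 0 => fun _ => ∅
  | k + 1 => fun i =>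
      match alg k (restrictVal v k) with
      | some j => if i = j then insert k (runGoods alg v k i) else runGoods alg v k i
      | none => runGoods alg v k i

/-- A deterministic online algorithm for chores with `n` agents: every arriving chore
must be assigned to some agent, based only on the costs restricted to arrived chores. -/
abbrev ChoresAlg (n : ℕ) : Type := ℕ → (Fin n → Finset ℕ → ℝ) → Fin n

/-- The (complete) allocation produced by a chores algorithm after `k` rounds. -/
def runChores {n : ℕ} (alg : ChoresAlg n) (c : Fin n → Finset ℕ → ℝ) : ℕ → Fin n → Finset ℕ
  | 0 => fun _ => ∅
  | k + 1 => fun i =>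
      if i = alg k (restrictVal c k) then insert k (runChores alg c k i)
      else runChores alg c k i

/-- A normalized monotone (hence nonnegative) valuation / cost function. -/
def IsVal (v : Finset ℕ → ℝ) : Prop :=
  v ∅ = 0 ∧ ∀ S T : Finset ℕ, S ⊆ T → v S ≤ v T

/-- Additive set function. -/
def AdditiveVal (v : Finset ℕ → ℝ) : Prop :=
  ∀ S : Finset ℕ, v S = ∑ e ∈ S, v {e}

/-- Tri-valued singleton values: `v {e} ∈ {a, b, z}` with `0 < a ≤ b ≤ z`. -/
def TriValuedVal (v : Finset ℕ → ℝ) : Prop :=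
  ∃ a b z : ℝ, 0 < a ∧ a ≤ b ∧ b ≤ z ∧ ∀ e : ℕ, v {e} = a ∨ v {e} = b ∨ v {e} = z

/-- Bi-valued singleton values: `v {e} ∈ {a, b}` with `0 < a ≤ b`. -/
def BiValuedVal (v : Finset ℕ → ℝ) : Prop :=
  ∃ a b : ℝ, 0 < a ∧ a ≤ b ∧ ∀ e : ℕ, v {e} = a ∨ v {e} = b

/-- Binary singleton values: `v {e} ∈ {0, 1}`. -/
def BinaryVal (v : Finset ℕ → ℝ) : Prop :=
  ∀ e : ℕ, v {e} = 0 ∨ v {e} = 1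

def Submodular (v : Finset ℕ → ℝ) : Prop :=
  ∀ X Y : Finset ℕ, v (X ∪ Y) + v (X ∩ Y) ≤ v X + v Y

def Supermodular (v : Finset ℕ → ℝ) : Prop :=
  ∀ X Y : Finset ℕ, v X + v Y ≤ v (X ∪ Y) + v (X ∩ Y)

/-- Every marginal value `v (X ∪ {e}) - v X` lies in `{0, 1}`. -/
def BinaryMarginals (v : Finset ℕ → ℝ) : Prop :=
  ∀ (X : Finset ℕ) (e : ℕ), v (insert e X) = v X ∨ v (insert e X) = v X + 1

/-- Submodular binary valuation (equivalently, a matroid rank function). -/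
def SubmodularBinary (v : Finset ℕ → ℝ) : Prop :=
  IsVal v ∧ Submodular v ∧ BinaryMarginals v

/-- Supermodular binary cost function. -/
def SupermodularBinary (v : Finset ℕ → ℝ) : Prop :=
  IsVal v ∧ Supermodular v ∧ BinaryMarginals v

/-- `B` is an allocation of (part of) the item set `T`:
pairwise disjoint bundles of items from `T`. -/
def IsAlloc (n : ℕ) (T : Finset ℕ) (B : Fin n → Finset ℕ) : Prop :=
  (∀ i, B i ⊆ T) ∧ ∀ i j, i ≠ j → Disjoint (B i) (B j)

/-- Every item of `T` is assigned to some agent. -/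
def Complete (n : ℕ) (T : Finset ℕ) (A : Fin n → Finset ℕ) : Prop :=
  ∀ e ∈ T, ∃ i, e ∈ A i

/-- `B` is a partition of `T` into `n` (possibly empty) bundles. -/
def IsPartition (n : ℕ) (T : Finset ℕ) (B : Fin n → Finset ℕ) : Prop :=
  IsAlloc n T B ∧ Complete n T B

/-- Non-wastefulness of the allocation `A` of the arrived goods `T`:
every allocated good has strictly positive marginal value inside its bundle, and
every discarded good has zero marginal value with respect to every agent's bundle. -/
def NonWasteful (n : ℕ) (v : Fin n → Finset ℕ → ℝ) (T : Finset ℕ)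
    (A : Fin n → Finset ℕ) : Prop :=
  (∀ i, ∀ e ∈ A i, v i ((A i).erase e) < v i (A i)) ∧
  (∀ i, ∀ e ∈ T, (∀ j, e ∉ A j) → v i (insert e (A i)) = v i (A i))

/-- `α`-EF1 for goods. -/
def EF1Goods (n : ℕ) (α : ℝ) (v : Fin n → Finset ℕ → ℝ) (A : Fin n → Finset ℕ) : Prop :=
  ∀ i j : Fin n, (A j).Nonempty → ∃ e ∈ A j, α * v i ((A j).erase e) ≤ v i (A i)

/-- `α`-MMS for goods: for every `n`-partition `B` of the arrived items, agent `i`'s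
value is at least `α` times the minimum bundle value of `B` (i.e. at least `α` times
the value of some bundle of `B`); this says `v i (A i) ≥ α · MMS_i`. -/
def MMSGoods (n : ℕ) (α : ℝ) (v : Fin n → Finset ℕ → ℝ) (T : Finset ℕ)
    (A : Fin n → Finset ℕ) : Prop :=
  ∀ i : Fin n, ∀ B : Fin n → Finset ℕ, IsPartition n T B → ∃ j, α * v i (B j) ≤ v i (A i)

/-- `α`-max-USW: the utilitarian social welfare of `A` is at least `α` times that of
any allocation of the arrived items. -/
def MaxUSW (n : ℕ) (α : ℝ) (v : Fin n → Finset ℕ → ℝ) (T : Finset ℕ)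
    (A : Fin n → Finset ℕ) : Prop :=
  ∀ B : Fin n → Finset ℕ, IsAlloc n T B → α * ∑ i, v i (B i) ≤ ∑ i, v i (A i)

/-- `α`-EF1 for chores. -/
def EF1Chores (n : ℕ) (α : ℝ) (c : Fin n → Finset ℕ → ℝ) (A : Fin n → Finset ℕ) : Prop :=
  ∀ i j : Fin n, (A i).Nonempty → ∃ e ∈ A i, c i ((A i).erase e) ≤ α * c i (A j)

/-- `α`-MMS (minimax share) for chores: for every `n`-partition `B` of the arrived
chores, agent `i`'s cost is at most `α` times the maximum bundle cost of `B`
(i.e. at most `α` times the cost of some bundle of `B`); this says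
`c i (A i) ≤ α · MMS_i`. -/
def MMSChores (n : ℕ) (α : ℝ) (c : Fin n → Finset ℕ → ℝ) (T : Finset ℕ)
    (A : Fin n → Finset ℕ) : Prop :=
  ∀ i : Fin n, ∀ B : Fin n → Finset ℕ, IsPartition n T B → ∃ j, c i (A i) ≤ α * c i (B j)

/-- `α`-min-USC: the utilitarian social cost of `A` is at most `α` times that of any
complete allocation of the arrived chores. -/
def MinUSC (n : ℕ) (α : ℝ) (c : Fin n → Finset ℕ → ℝ) (T : Finset ℕ)
    (A : Fin n → Finset ℕ) : Prop :=
  ∀ B : Fin n → Finset ℕ, IsPartition n T B → ∑ i, c i (A i) ≤ α * ∑ i, c i (B i)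

theorem runGoods_succ_some {n : ℕ} {alg : GoodsAlg n} {v : Fin n → Finset ℕ → ℝ} {k : ℕ}
    {j : Fin n} (h : alg k (restrictVal v k) = some j) (i : Fin n) :
    runGoods alg v (k + 1) i =
      if i = j then insert k (runGoods alg v k i) else runGoods alg v k i := by
  simp only [runGoods, h]

theorem runGoods_succ_none {n : ℕ} {alg : GoodsAlg n} {v : Fin n → Finset ℕ → ℝ} {k : ℕ}
    (h : alg k (restrictVal v k) = none) (i : Fin n) :
    runGoods alg v (k + 1) i = runGoods alg v k i := by
  simp only [runGoods, h]

theorem runGoods_subset_range {n : ℕ} (alg : GoodsAlg n) (v : Fin n → Finset ℕ → ℝ) (k : ℕ)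
    (i : Fin n) : runGoods alg v k i ⊆ range k := by
  induction k with
  | zero => simp [runGoods]
  | succ k ih =>
    have ih' : runGoods alg v k i ⊆ range (k + 1) :=
      ih.trans (range_subset_range.2 k.le_succ)
    cases h : alg k (restrictVal v k) with
    | none => rwa [runGoods_succ_none h]
    | some j =>
      rw [runGoods_succ_some h]
      split_ifs
      · exact insert_subset (mem_range.2 k.lt_succ_self) ih'
      · exact ih'

/-- The additive set function with the given singleton values. -/
def additiveOf {n : ℕ} (w : Fin n → ℕ → ℝ) (i : Fin n) (S : Finset ℕ) : ℝ :=
  ∑ e ∈ S, w i e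

theorem additiveVal_additiveOf {n : ℕ} (w : Fin n → ℕ → ℝ) (i : Fin n) :
    AdditiveVal (additiveOf w i) := by
  intro S
  simp [additiveOf]

/-- If all goods have positive value, discarding the newest good is wasteful. -/
theorem not_nonWasteful_of_discard {n : ℕ} [NeZero n] {alg : GoodsAlg n} {w : Fin n → ℕ → ℝ}
    {k : ℕ} (hw : 0 < w 0 k) (h : alg k (restrictVal (additiveOf w) k) = none) :
    ¬ NonWasteful n (additiveOf w) (range (k + 1)) (runGoods alg (additiveOf w) (k + 1)) := by
  intro hNW
  have hk : ∀ j, k ∉ runGoods alg (additiveOf w) (k + 1) j := by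
    intro j hj
    rw [runGoods_succ_none h] at hj
    exact lt_irrefl k (mem_range.1 (runGoods_subset_range _ _ _ _ hj))
  have key := hNW.2 0 k (mem_range.2 k.lt_succ_self) hk
  simp only [additiveOf] at key
  rw [sum_insert (hk 0)] at key
  linarith

theorem isPartition_of_subset {T X : Finset ℕ} (hX : X ⊆ T) (p : Fin 2) :
    IsPartition 2 T (fun i => if i = p then X else T \ X) := by
  refine ⟨⟨fun i => ?_, fun i j hij => ?_⟩, fun e he => ?_⟩
  · dsimp only
    split_ifs
    exacts [hX, sdiff_subset]
  · dsimp only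
    split_ifs with hi hj hj
    · exact absurd (hi.trans hj.symm) hij
    · exact disjoint_sdiff
    · exact sdiff_disjoint
    · omega
  · by_cases hX' : e ∈ X
    · exact ⟨p, by simpa using hX'⟩
    · refine ⟨p + 1, ?_⟩
      have : p + 1 ≠ p := by fin_cases p <;> decide
      simp [this, he, hX']

/-- A single agent `i` who envies `j` too much and falls below a fraction `β` of the minimum
of some partition into two bundles refutes both fairness guarantees. -/
theorem not_EF1Goods_or_MMSGoods {α β : ℝ} {v : Fin 2 → Finset ℕ → ℝ} {T X : Finset ℕ}
    {A : Fin 2 → Finset ℕ} (i j : Fin 2) (hX : X ⊆ T) (hne : (A j).Nonempty)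
    (hEF : ∀ e ∈ A j, v i (A i) < α * v i ((A j).erase e))
    (h₁ : v i (A i) < β * v i X) (h₂ : v i (A i) < β * v i (T \ X)) :
    ¬ (EF1Goods 2 α v A ∨ MMSGoods 2 β v T A) := by
  rintro (h | h)
  · obtain ⟨e, he, hle⟩ := h i j hne
    exact (hEF e he).not_ge hle
  · obtain ⟨k, hk⟩ := h i _ (isPartition_of_subset hX i)
    split_ifs at hk
    exacts [h₁.not_ge hk, h₂.not_ge hk]

/-- Singleton values of the hard instance: agent `p` values the goods `1, 3, 3, …`
and the other agent values them `1, 1/3, 1, …`. -/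
noncomputable def hardValue (p i : Fin 2) (e : ℕ) : ℝ :=
  if i = p then (if e = 0 then 1 else 3) else (if e = 1 then 1 / 3 else 1)

theorem hardValue_pos (p i : Fin 2) (e : ℕ) : 0 < hardValue p i e := by
  unfold hardValue
  split_ifs <;> norm_num

theorem biValuedVal_hardValue (p i : Fin 2) : BiValuedVal (additiveOf (hardValue p) i) := by
  by_cases h : i = p
  · refine ⟨1, 3, by norm_num, by norm_num, fun e => ?_⟩
    by_cases he : e = 0 <;> simp [additiveOf, hardValue, h, he]
  · refine ⟨1 / 3, 1, by norm_num, by norm_num, fun e => ?_⟩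
    by_cases he : e = 1 <;> simp [additiveOf, hardValue, h, he]

/-- After the first good, the hard instances for different `p` are indistinguishable. -/
theorem restrictVal_hardValue_zero (p q : Fin 2) :
    restrictVal (additiveOf (hardValue p)) 0 = restrictVal (additiveOf (hardValue q)) 0 := by
  funext i S
  simp only [restrictVal, additiveOf]
  refine sum_congr rfl fun e he => ?_
  have : e = 0 := by simpa using (mem_inter.1 he).2
  subst this
  simp [hardValue]

/-- The hard instance for the agent `p` who receives the first good defeats the algorithm
in at most three rounds. -/
theorem exists_unfair_of_first_to {ε : ℝ} (hε : 0 < ε) {alg : GoodsAlg 2} {p : Fin 2}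
    (h0 : alg 0 (restrictVal (additiveOf (hardValue p)) 0) = some p) :
    ∃ t : ℕ, ¬ (NonWasteful 2 (additiveOf (hardValue p)) (range t)
        (runGoods alg (additiveOf (hardValue p)) t) ∧
      (EF1Goods 2 (1 / 2 + ε) (additiveOf (hardValue p))
          (runGoods alg (additiveOf (hardValue p)) t) ∨
        MMSGoods 2 (1 / 3 + ε) (additiveOf (hardValue p)) (range t)
          (runGoods alg (additiveOf (hardValue p)) t))) := by
  set v := additiveOf (hardValue p) with hv
  obtain ⟨q, hqp, hq⟩ : ∃ q : Fin 2, q ≠ p ∧ ∀ i, i = p ∨ i = q := by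
    refine ⟨p + 1, ?_, ?_⟩ <;> fin_cases p <;> decide
  have hpq := hqp.symm
  have vp : ∀ S, v p S = ∑ e ∈ S, if e = 0 then (1 : ℝ) else 3 := by
    intro S; simp [hv, additiveOf, hardValue]
  have vq : ∀ S, v q S = ∑ e ∈ S, if e = 1 then (1 / 3 : ℝ) else 1 := by
    intro S; simp [hv, additiveOf, hardValue, hqp]
  have A1p : runGoods alg v 1 p = {0} := by rw [runGoods_succ_some h0]; simp [runGoods]
  have A1q : runGoods alg v 1 q = ∅ := by rw [runGoods_succ_some h0]; simp [runGoods, hqp]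
  cases h1 : alg 1 (restrictVal v 1) with
  | none => exact ⟨2, fun h => not_nonWasteful_of_discard (hardValue_pos _ _ _) h1 h.1⟩
  | some j =>
    rcases hq j with rfl | rfl
    · have A2p : runGoods alg v 2 j = {1, 0} := by simp [runGoods_succ_some h1, A1p]
      have A2q : runGoods alg v 2 q = ∅ := by simp [runGoods_succ_some h1, A1q, hqp]
      have hR : range 2 \ {0} = {1} := by decide
      refine ⟨2, fun h => not_EF1Goods_or_MMSGoods (X := {0}) q j (by decide)
        (by simp [A2p]) ?_ ?_ ?_ h.2⟩
      · rw [A2p, A2q]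
        intro e he
        have E0 : ({1, 0} : Finset ℕ).erase 0 = {1} := by decide
        have E1 : ({1, 0} : Finset ℕ).erase 1 = {0} := by decide
        simp only [mem_insert, mem_singleton] at he
        rcases he with rfl | rfl
        · rw [E1]; simp [vq]; positivity
        · rw [E0]; simp [vq]; positivity
      · rw [A2q]; simp [vq]; positivity
      · rw [A2q, hR]; simp [vq]; positivity
    · have A2p : runGoods alg v 2 p = {0} := by simp [runGoods_succ_some h1, A1p, hpq]
      have A2q : runGoods alg v 2 j = {1} := by simp [runGoods_succ_some h1, A1q]
      cases h2 : alg 2 (restrictVal v 2) with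
      | none => exact ⟨3, fun h => not_nonWasteful_of_discard (hardValue_pos _ _ _) h2 h.1⟩
      | some k =>
        rcases hq k with rfl | rfl
        · have A3p : runGoods alg v 3 k = {2, 0} := by simp [runGoods_succ_some h2, A2p]
          have A3q : runGoods alg v 3 j = {1} := by simp [runGoods_succ_some h2, A2q, hqp]
          have hR : range 3 \ {0} = {1, 2} := by decide
          refine ⟨3, fun h => not_EF1Goods_or_MMSGoods (X := {0}) j k (by decide)
            (by simp [A3p]) ?_ ?_ ?_ h.2⟩
          · rw [A3p, A3q]
            intro e he
            have E0 : ({2, 0} : Finset ℕ).erase 0 = {2} := by decide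
            have E1 : ({2, 0} : Finset ℕ).erase 2 = {0} := by decide
            simp only [mem_insert, mem_singleton] at he
            rcases he with rfl | rfl
            · rw [E1]; norm_num [vq]; linarith
            · rw [E0]; norm_num [vq]; linarith
          · rw [A3q]; norm_num [vq]; linarith
          · rw [A3q, hR]; norm_num [vq]; linarith
        · have A3p : runGoods alg v 3 p = {0} := by simp [runGoods_succ_some h2, A2p, hpq]
          have A3q : runGoods alg v 3 k = {2, 1} := by simp [runGoods_succ_some h2, A2q]
          have hR : range 3 \ {2} = {0, 1} := by decide
          refine ⟨3, fun h => not_EF1Goods_or_MMSGoods (X := {2}) p k (by decide)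
            (by simp [A3q]) ?_ ?_ ?_ h.2⟩
          · rw [A3p, A3q]
            intro e he
            have E0 : ({2, 1} : Finset ℕ).erase 1 = {2} := by decide
            have E1 : ({2, 1} : Finset ℕ).erase 2 = {1} := by decide
            simp only [mem_insert, mem_singleton] at he
            rcases he with rfl | rfl
            · rw [E1]; norm_num [vp]; linarith
            · rw [E0]; norm_num [vp]; linarith
          · rw [A3p]; norm_num [vp]; linarith
          · rw [A3p, hR]; norm_num [vp]; linarith

/-- for two agents with additive bi-valued valuations, no deterministic
online goods algorithm computes a non-wasteful allocation that is `(1/2+ε)`-EF1 or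
`(1/3+ε)`-MMS. -/
theorem goods_biValued_upper_EF1_MMS :
    ∀ ε : ℝ, 0 < ε → ε ≤ 1 / 2 →
    ∀ alg : GoodsAlg 2,
    ∃ (t : ℕ) (v : Fin 2 → Finset ℕ → ℝ),
      (∀ i, AdditiveVal (v i)) ∧ (∀ i, BiValuedVal (v i)) ∧
      ¬ (NonWasteful 2 v (Finset.range t) (runGoods alg v t) ∧
          (EF1Goods 2 (1 / 2 + ε) v (runGoods alg v t) ∨
            MMSGoods 2 (1 / 3 + ε) v (Finset.range t) (runGoods alg v t))) := by
  intro ε hε _ alg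
  cases h0 : alg 0 (restrictVal (additiveOf (hardValue 0)) 0) with
  | none =>
    exact ⟨1, _, fun i => additiveVal_additiveOf _ i, fun i => biValuedVal_hardValue 0 i,
      fun h => not_nonWasteful_of_discard (hardValue_pos _ _ _) h0 h.1⟩
  | some p =>
    rw [restrictVal_hardValue_zero 0 p] at h0
    obtain ⟨t, ht⟩ := exists_unfair_of_first_to hε h0
    exact ⟨t, _, fun i => additiveVal_additiveOf _ i, fun i => biValuedVal_hardValue p i, ht⟩

end OnlineFair
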